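/- Let p be an odd prime and G = H₃(𝔽_p[t]/(t²)). The number of cohomology classes in H²(G, ℂˣ) that contain a non-degenerate 2-cocycle equals p⁵(p−1)²(p+1). -/

import Mathlib

open Polynomial

/-- The Heisenberg group `H₃(R)` of 3×3 upper unitriangular matrices over a commutative
ring `R`.  An element is determined by its entries: `b` is the (1,2)-entry, `a` is the
(2,3)-entry and `c` is the (1,3)-entry; multiplication is matrix multiplication. -/
@[ext]
structure Heisenberg (R : Type*) [CommRing R] where
  a : R
  b : R
  c : R

namespace Heisenberg

variable {R : Type*} [CommRing R]

instance : Mul (Heisenberg R) :=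
  ⟨fun x y => ⟨x.a + y.a, x.b + y.b, x.c + y.c + x.b * y.a⟩⟩

instance : One (Heisenberg R) := ⟨⟨0, 0, 0⟩⟩

instance : Inv (Heisenberg R) := ⟨fun x => ⟨-x.a, -x.b, -x.c + x.b * x.a⟩⟩

@[simp] lemma mul_a (x y : Heisenberg R) : (x * y).a = x.a + y.a := rfl
@[simp] lemma mul_b (x y : Heisenberg R) : (x * y).b = x.b + y.b := rfl
@[simp] lemma mul_c (x y : Heisenberg R) : (x * y).c = x.c + y.c + x.b * y.a := rfl
@[simp] lemma one_a : (1 : Heisenberg R).a = 0 := rfl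
@[simp] lemma one_b : (1 : Heisenberg R).b = 0 := rfl
@[simp] lemma one_c : (1 : Heisenberg R).c = 0 := rfl
@[simp] lemma inv_a (x : Heisenberg R) : x⁻¹.a = -x.a := rfl
@[simp] lemma inv_b (x : Heisenberg R) : x⁻¹.b = -x.b := rfl
@[simp] lemma inv_c (x : Heisenberg R) : x⁻¹.c = -x.c + x.b * x.a := rfl

/-- Matrix multiplication of unitriangular matrices makes `H₃(R)` a group. -/
instance : Group (Heisenberg R) where
  mul := (· * ·)
  one := 1
  inv := (·⁻¹)
  mul_assoc x y z := by ext <;> simp only [mul_a, mul_b, mul_c] <;> ring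
  one_mul x := by ext <;> simp only [mul_a, mul_b, mul_c, one_a, one_b, one_c] <;> ring
  mul_one x := by ext <;> simp only [mul_a, mul_b, mul_c, one_a, one_b, one_c] <;> ring
  inv_mul_cancel x := by
    ext <;> simp only [mul_a, mul_b, mul_c, inv_a, inv_b, inv_c, one_a, one_b, one_c] <;> ring

end Heisenberg

section Cocycles

variable {G : Type*} [Group G]

/-- A (normalized) `2`-cocycle of `G` with values in `ℂˣ` (trivial action):
`α(1,1) = 1` and `α(x,y)α(xy,z) = α(x,yz)α(y,z)`. -/
def IsMul2Cocycle (α : G × G → ℂˣ) : Prop :=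
  α (1, 1) = 1 ∧ ∀ x y z : G, α (x, y) * α (x * y, z) = α (x, y * z) * α (y, z)

/-- A (normalized) `2`-coboundary of `G` with values in `ℂˣ`. -/
def IsMul2Coboundary (β : G × G → ℂˣ) : Prop :=
  ∃ f : G → ℂˣ, f 1 = 1 ∧ ∀ x y : G, β (x, y) = f x * f y * (f (x * y))⁻¹

/-- Two `2`-cocycles `α, α'` are cohomologous if they differ by a `2`-coboundary:
`α'(x,y) = f(x)f(y)f(xy)⁻¹α(x,y)` for some `f : G → ℂˣ` with `f 1 = 1`. -/
def IsCohomologous (α α' : G × G → ℂˣ) : Prop :=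
  ∃ f : G → ℂˣ, f 1 = 1 ∧ ∀ x y : G, α' (x, y) = f x * f y * (f (x * y))⁻¹ * α (x, y)

/-- The group of normalized `2`-cocycles of `G` with values in `ℂˣ`. -/
def mul2Cocycles (G : Type*) [Group G] : Subgroup ((G × G) → ℂˣ) where
  carrier := {α | IsMul2Cocycle α}
  one_mem' := ⟨rfl, fun _ _ _ => rfl⟩
  mul_mem' {a b} ha hb := by
    refine ⟨by simp only [Pi.mul_apply, ha.1, hb.1, one_mul], fun x y z => ?_⟩
    simp only [Pi.mul_apply]
    rw [mul_mul_mul_comm, ha.2 x y z, hb.2 x y z, mul_mul_mul_comm]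
  inv_mem' {a} ha := by
    refine ⟨by simp only [Pi.inv_apply, ha.1, inv_one], fun x y z => ?_⟩
    simp only [Pi.inv_apply]
    rw [← mul_inv, ← mul_inv, ha.2 x y z]

/-- The group of `2`-coboundaries of `G` with values in `ℂˣ`. -/
def mul2Coboundaries (G : Type*) [Group G] : Subgroup ((G × G) → ℂˣ) where
  carrier := {β | IsMul2Coboundary β}
  one_mem' := ⟨1, rfl, fun x y => by simp⟩
  mul_mem' {a b} ha hb := by
    obtain ⟨f, hf1, hf⟩ := ha
    obtain ⟨g, hg1, hg⟩ := hb
    refine ⟨f * g, by simp [hf1, hg1], fun x y => ?_⟩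
    simp only [Pi.mul_apply, hf x y, hg x y, mul_inv]
    rw [mul_mul_mul_comm (f x) (g x) (f y) (g y),
      mul_mul_mul_comm (f x * f y) (g x * g y) (f (x * y))⁻¹ (g (x * y))⁻¹]
  inv_mem' {a} ha := by
    obtain ⟨f, hf1, hf⟩ := ha
    refine ⟨f⁻¹, by simp [hf1], fun x y => ?_⟩
    simp only [Pi.inv_apply, hf x y, mul_inv, inv_inv]

/-- The Schur multiplier `H²(G, ℂˣ)`: the second group cohomology of `G` with
coefficients in `ℂˣ` (trivial action), realized as normalized `2`-cocycles modulo
`2`-coboundaries. -/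
abbrev SchurMultiplier (G : Type*) [Group G] :=
  mul2Cocycles G ⧸ (mul2Coboundaries G).subgroupOf (mul2Cocycles G)

end Cocycles

/-- `α` is a non-degenerate `2`-cocycle of the finite group `G`: there exists an
irreducible projective `α`-representation `ρ : G → GL(V)` on a nonzero finite-dimensional
complex vector space `V` (so `ρ 1 = id` and `ρ(xy) = α(x,y)ρ(x)ρ(y)`, with no invariant
subspaces other than `0` and `V`) whose dimension is `√|G|`. -/
def IsNonDegenerate {G : Type*} [Group G] (α : G × G → ℂˣ) : Prop :=
  ∃ (V : Type) (_ : AddCommGroup V) (_ : Module ℂ V) (ρ : G → V →ₗ[ℂ] V),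
    FiniteDimensional ℂ V ∧ Nontrivial V ∧
    ρ 1 = LinearMap.id ∧
    (∀ x y : G, ρ (x * y) = (α (x, y) : ℂ) • (ρ x ∘ₗ ρ y)) ∧
    (∀ g : G, Function.Bijective (ρ g)) ∧
    (∀ W : Submodule ℂ V, (∀ (g : G), ∀ v ∈ W, ρ g v ∈ W) → W = ⊥ ∨ W = ⊤) ∧
    Module.finrank ℂ V ^ 2 = Nat.card G

section CommutatorPairing

open scoped commutatorElement

variable {G : Type*}

/-- The quotient `α(x,y) / α(y,x)`; on commuting pairs it depends only on the class of `α`. -/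
noncomputable def commPairing (α : G × G → ℂˣ) (x y : G) : ℂˣ := α (x, y) * (α (y, x))⁻¹

theorem commPairing_swap (α : G × G → ℂˣ) (x y : G) :
    commPairing α y x = (commPairing α x y)⁻¹ := by
  simp [commPairing, mul_comm]

theorem commPairing_self (α : G × G → ℂˣ) (x : G) : commPairing α x x = 1 := by
  simp [commPairing]

theorem commPairing_mul (α β : G × G → ℂˣ) (x y : G) :
    commPairing (α * β) x y = commPairing α x y * commPairing β x y := by
  simp [commPairing, mul_mul_mul_comm, mul_comm]

theorem commPairing_inv (α : G × G → ℂˣ) (x y : G) :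
    commPairing α⁻¹ x y = (commPairing α x y)⁻¹ := by
  simp [commPairing, mul_comm]

variable [Group G]

namespace IsMul2Cocycle

variable {α : G × G → ℂˣ}

theorem one_left (hα : IsMul2Cocycle α) (x : G) : α (1, x) = 1 := by
  have := hα.2 1 1 x
  simpa [hα.1] using this

theorem one_right (hα : IsMul2Cocycle α) (x : G) : α (x, 1) = 1 := by
  have := hα.2 x 1 1
  simpa [hα.1] using this

theorem commPairing_mul_right (hα : IsMul2Cocycle α) {x y z : G} (hy : x * y = y * x)
    (hz : x * z = z * x) : commPairing α x (y * z) = commPairing α x y * commPairing α x z := by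
  have h1 := hα.2 x y z
  have h2 := hα.2 y x z
  have h3 := hα.2 y z x
  rw [hy] at h1
  rw [hz] at h2
  simp only [commPairing]
  have e1 : α (x, y * z) = α (x, y) * α (y * x, z) * (α (y, z))⁻¹ := by rw [h1]; simp
  have e2 : α (y * z, x) = α (y, z * x) * α (z, x) * (α (y, z))⁻¹ := by rw [← h3]; simp
  have e3 : α (y, z * x) = α (y, x) * α (y * x, z) * (α (x, z))⁻¹ := by rw [h2]; simp
  rw [e1, e2, e3]
  apply Units.ext
  push_cast
  field_simp

theorem commPairing_mul_left (hα : IsMul2Cocycle α) {x y z : G} (hx : x * z = z * x)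
    (hy : y * z = z * y) : commPairing α (x * y) z = commPairing α x z * commPairing α y z := by
  rw [commPairing_swap α z, hα.commPairing_mul_right hx.symm hy.symm, mul_inv,
    ← commPairing_swap, ← commPairing_swap]

theorem commPairing_one_right (hα : IsMul2Cocycle α) (x : G) : commPairing α x 1 = 1 := by
  simp [commPairing, hα.one_left, hα.one_right]

theorem commPairing_pow_right (hα : IsMul2Cocycle α) {x y : G} (hxy : x * y = y * x) (n : ℕ) :
    commPairing α x (y ^ n) = commPairing α x y ^ n := by
  induction n with
  | zero => simp [hα.commPairing_one_right]
  | succ n ih =>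
    have h : Commute x (y ^ n) := Commute.pow_right hxy n
    rw [pow_succ, hα.commPairing_mul_right h hxy, ih, pow_succ]

end IsMul2Cocycle

theorem IsMul2Coboundary.commPairing_eq_one {α : G × G → ℂˣ} (hα : IsMul2Coboundary α) {x y : G}
    (hxy : x * y = y * x) : commPairing α x y = 1 := by
  obtain ⟨f, -, hf⟩ := hα
  rw [commPairing, hf, hf, hxy, mul_comm (f y), mul_inv_cancel]

/-- The central extension of `G` by `ℂˣ` defined by a `2`-cocycle. -/
@[ext]
structure TwistedExtension (α : mul2Cocycles G) where
  scalar : ℂˣ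
  base : G

namespace TwistedExtension

variable {α : mul2Cocycles G}

instance : Mul (TwistedExtension α) :=
  ⟨fun x y => ⟨x.scalar * y.scalar * α.1 (x.base, y.base), x.base * y.base⟩⟩

instance : One (TwistedExtension α) := ⟨⟨1, 1⟩⟩

instance : Inv (TwistedExtension α) :=
  ⟨fun x => ⟨x.scalar⁻¹ * (α.1 (x.base⁻¹, x.base))⁻¹, x.base⁻¹⟩⟩

@[simp] theorem mul_scalar (x y : TwistedExtension α) :
    (x * y).scalar = x.scalar * y.scalar * α.1 (x.base, y.base) := rfl
@[simp] theorem mul_base (x y : TwistedExtension α) : (x * y).base = x.base * y.base := rfl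
@[simp] theorem one_scalar : (1 : TwistedExtension α).scalar = 1 := rfl
@[simp] theorem one_base : (1 : TwistedExtension α).base = 1 := rfl
@[simp] theorem inv_scalar (x : TwistedExtension α) :
    x⁻¹.scalar = x.scalar⁻¹ * (α.1 (x.base⁻¹, x.base))⁻¹ := rfl
@[simp] theorem inv_base (x : TwistedExtension α) : x⁻¹.base = x.base⁻¹ := rfl

instance : Group (TwistedExtension α) :=
  Group.ofLeftAxioms
    (fun x y z => by
      ext1
      · have h : α.1 (x.base, y.base) * α.1 (x.base * y.base, z.base) =
          α.1 (x.base, y.base * z.base) * α.1 (y.base, z.base) := α.2.2 _ _ _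
        calc x.scalar * y.scalar * α.1 (x.base, y.base) * z.scalar *
              α.1 (x.base * y.base, z.base)
            = x.scalar * y.scalar * z.scalar *
              (α.1 (x.base, y.base) * α.1 (x.base * y.base, z.base)) := by
                simp only [mul_comm, mul_left_comm, mul_assoc]
          _ = x.scalar * (y.scalar * z.scalar * α.1 (y.base, z.base)) *
              α.1 (x.base, y.base * z.base) := by
                rw [h]; simp only [mul_comm, mul_left_comm, mul_assoc]
      · exact mul_assoc _ _ _)
    (fun x => by ext1 <;> simp [IsMul2Cocycle.one_left α.2])
    (fun x => by
      ext1
      · change x.scalar⁻¹ * (α.1 (x.base⁻¹, x.base))⁻¹ * x.scalar * α.1 (x.base⁻¹, x.base) = 1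
        rw [mul_right_comm, inv_mul_cancel_right, inv_mul_cancel]
      · exact inv_mul_cancel _)

/-- The inclusion of the scalars. -/
def ofScalar : ℂˣ →* TwistedExtension α where
  toFun s := ⟨s, 1⟩
  map_one' := rfl
  map_mul' s t := by ext1 <;> simp [IsMul2Cocycle.one_left α.2]

@[simp] theorem ofScalar_scalar (s : ℂˣ) : (ofScalar s : TwistedExtension α).scalar = s := rfl
@[simp] theorem ofScalar_base (s : ℂˣ) : (ofScalar s : TwistedExtension α).base = 1 := rfl

theorem ofScalar_injective : Function.Injective (ofScalar : ℂˣ → TwistedExtension α) :=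
  fun _ _ h => congrArg scalar h

theorem ofScalar_comm (s : ℂˣ) (x : TwistedExtension α) : ofScalar s * x = x * ofScalar s := by
  ext1 <;> simp [IsMul2Cocycle.one_left α.2, IsMul2Cocycle.one_right α.2, mul_comm]

/-- The standard set-theoretic section. -/
def lift (x : G) : TwistedExtension α := ⟨1, x⟩

@[simp] theorem lift_scalar (x : G) : (lift x : TwistedExtension α).scalar = 1 := rfl
@[simp] theorem lift_base (x : G) : (lift x : TwistedExtension α).base = x := rfl

theorem lift_mul_lift (x y : G) :
    (lift x * lift y : TwistedExtension α) = ofScalar (α.1 (x, y)) * lift (x * y) := by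
  ext1 <;> simp [IsMul2Cocycle.one_left α.2]

theorem eq_ofScalar_mul_lift (x : TwistedExtension α) : x = ofScalar x.scalar * lift x.base := by
  ext1 <;> simp [IsMul2Cocycle.one_left α.2]

theorem mul_eq_commPairing {x y : TwistedExtension α} (h : x.base * y.base = y.base * x.base) :
    x * y = ofScalar (commPairing α.1 x.base y.base) * (y * x) := by
  ext1
  · simp only [mul_scalar, mul_base, ofScalar_scalar, ofScalar_base,
      IsMul2Cocycle.one_left α.2, mul_one, commPairing]
    apply Units.ext
    push_cast
    field_simp
  · simpa using h

theorem _root_.IsMul2Cocycle.commPairing_conj {β : G × G → ℂˣ} (hβ : IsMul2Cocycle β)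
    {g x y x' y' : G} (hxy : x * y = y * x) (hx : g * x = x' * g) (hy : g * y = y' * g) :
    commPairing β x' y' = commPairing β x y := by
  obtain rfl : x' = g * x * g⁻¹ := by rw [hx, mul_inv_cancel_right]
  obtain rfl : y' = g * y * g⁻¹ := by rw [hy, mul_inv_cancel_right]
  let β' : mul2Cocycles G := ⟨β, hβ⟩
  let k : TwistedExtension β' := lift g
  have h1 := mul_eq_commPairing (α := β') (x := lift x) (y := lift y) hxy
  have h2 := mul_eq_commPairing (α := β') (x := k * lift x * k⁻¹) (y := k * lift y * k⁻¹)
    (by simpa [k] using hxy)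
  have h3 : k * lift x * k⁻¹ * (k * lift y * k⁻¹) = ofScalar (commPairing β x y) *
      (k * lift y * k⁻¹ * (k * lift x * k⁻¹)) := by
    calc _ = k * (lift x * lift y) * k⁻¹ := by group
      _ = k * ofScalar (commPairing β x y) * (lift y * lift x) * k⁻¹ := by
        rw [h1]; simp only [mul_assoc]; rfl
      _ = _ := by rw [← ofScalar_comm]; group
  exact ofScalar_injective (mul_right_cancel (h2.symm.trans h3))

/-- A `2`-cocycle is a coboundary as soon as the scalars inject into some abelian quotient of the
extension it defines. -/
theorem isMul2Coboundary_of_quotient (D : Subgroup (TwistedExtension α)) [D.Normal]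
    (hcomm : ∀ x y : TwistedExtension α, ⁅x, y⁆ ∈ D) (hD : ∀ s : ℂˣ, ofScalar s ∈ D → s = 1) :
    IsMul2Coboundary α.1 := by
  let _ : CommGroup (TwistedExtension α ⧸ D) :=
    { (inferInstance : Group (TwistedExtension α ⧸ D)) with
      mul_comm := fun x y => by
        induction x using QuotientGroup.induction_on with | H x => ?_
        induction y using QuotientGroup.induction_on with | H y => ?_
        refine (QuotientGroup.eq).mpr ?_
        have := hcomm y⁻¹ x⁻¹
        simpa [commutatorElement_def, mul_assoc] using this }
  let i : ℂˣ →* TwistedExtension α ⧸ D := (QuotientGroup.mk' D).comp ofScalar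
  have hi : Function.Injective i := by
    refine (injective_iff_map_eq_one i).mpr fun s hs => hD s ?_
    exact (QuotientGroup.eq_one_iff _).mp hs
  have hdiv : DivisibleBy (Additive ℂˣ) ℤ := divisibleByOfSMulRightSurj _ _ fun {n} hn x => by
    obtain ⟨z, hz⟩ := IsAlgClosed.exists_pow_nat_eq ((x.toMul : ℂˣ) : ℂ)
      (Int.natAbs_pos.mpr hn)
    have hz0 : z ≠ 0 := fun h => by
      rw [h, zero_pow (Int.natAbs_ne_zero.mpr hn)] at hz
      exact x.toMul.ne_zero hz.symm
    have hu : (Units.mk0 z hz0) ^ n.natAbs = x.toMul := Units.ext (by simpa using hz)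
    rcases Int.natAbs_eq n with h | h
    · refine ⟨Additive.ofMul (Units.mk0 z hz0), ?_⟩
      change n • Additive.ofMul (Units.mk0 z hz0) = x
      rw [h, natCast_zsmul, ← ofMul_pow, hu, ofMul_toMul]
    · refine ⟨-Additive.ofMul (Units.mk0 z hz0), ?_⟩
      change n • -Additive.ofMul (Units.mk0 z hz0) = x
      rw [h, neg_smul_neg, natCast_zsmul, ← ofMul_pow, hu, ofMul_toMul]
  obtain ⟨χ, hχ⟩ := (Module.Baer.of_divisible (Additive ℂˣ)).extension_property_addMonoidHom
    i.toAdditive hi (AddMonoidHom.id (Additive ℂˣ))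
  let f : TwistedExtension α →* ℂˣ := (MonoidHom.toAdditive.symm χ).comp
    (QuotientGroup.mk' D)
  have hf : ∀ s, f (ofScalar s) = s := fun s => congr(($hχ (Additive.ofMul s)).toMul)
  refine ⟨fun x => f (lift x), map_one f, fun x y => ?_⟩
  rw [← map_mul, lift_mul_lift, map_mul, hf, mul_inv_cancel_right]

end TwistedExtension

end CommutatorPairing

section ProjectiveRepresentations

/-- **Burnside's theorem**: a subalgebra of `End V` without invariant subspaces is `End V`. -/
theorem Subalgebra.eq_top_of_irreducible {V : Type*} [AddCommGroup V] [Module ℂ V]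
    [FiniteDimensional ℂ V] [Nontrivial V] (A : Subalgebra ℂ (Module.End ℂ V))
    (hA : ∀ W : Submodule ℂ V, (∀ f ∈ A, ∀ v ∈ W, f v ∈ W) → W = ⊥ ∨ W = ⊤) : A = ⊤ := by
  have hsimple : IsSimpleModule A V := by
    rw [isSimpleModule_iff]
    refine { exists_pair_ne := ⟨⊥, ⊤, bot_ne_top⟩, eq_bot_or_eq_top := fun W => ?_ }
    rcases hA (W.restrictScalars ℂ) (fun f hf v hv => W.smul_mem (⟨f, hf⟩ : A) hv) with h | h
    · exact Or.inl (by simpa using h)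
    · exact Or.inr (by simpa using h)
  have hschur := IsSimpleModule.algebraMap_end_bijective_of_isAlgClosed (A := A) (V := V) ℂ
  have : Module.Finite (Module.End A V) V :=
    Module.Finite.of_restrictScalars_finite ℂ (Module.End A V) V
  refine eq_top_iff.mpr fun f _ => ?_
  let f' : Module.End (Module.End A V) V :=
    { toFun := f
      map_add' := f.map_add
      map_smul' := fun c v => by
        obtain ⟨z, rfl⟩ := hschur.2 c
        simp }
  obtain ⟨a, ha⟩ := Module.Finite.toModuleEnd_moduleEnd_surjective (R := A) (M := V) f'
  have hfa : f = (a : Module.End ℂ V) := LinearMap.ext fun v => congr($ha v).symm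
  exact hfa ▸ a.2

variable {G : Type} [Group G]

/-- `ρ` is a projective representation with multiplier `α`. -/
structure IsProjRep (α : G × G → ℂˣ) {V : Type*} [AddCommGroup V] [Module ℂ V]
    (ρ : G → Module.End ℂ V) : Prop where
  map_one : ρ 1 = 1
  map_mul : ∀ x y, ρ (x * y) = (α (x, y) : ℂ) • (ρ x * ρ y)

namespace IsProjRep

variable {α : G × G → ℂˣ} {V : Type*} [AddCommGroup V] [Module ℂ V] {ρ : G → Module.End ℂ V}

theorem mul_eq (h : IsProjRep α ρ) (x y : G) :
    ρ x * ρ y = ((α (x, y))⁻¹ : ℂˣ) • ρ (x * y) := by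
  rw [h.map_mul, Units.smul_def, smul_smul, Units.inv_mul, one_smul]

theorem mul_inv_eq (h : IsProjRep α ρ) (x : G) :
    ρ x * (α (x, x⁻¹) • ρ x⁻¹) = 1 := by
  rw [mul_smul_comm, h.mul_eq, smul_smul, mul_inv_cancel, mul_inv_cancel, one_smul, h.map_one]

theorem inv_mul_eq (h : IsProjRep α ρ) [FiniteDimensional ℂ V] (x : G) :
    (α (x, x⁻¹) • ρ x⁻¹) * ρ x = 1 :=
  mul_eq_one_comm.mp (h.mul_inv_eq x)

theorem bijective (h : IsProjRep α ρ) [FiniteDimensional ℂ V] (x : G) :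
    Function.Bijective (ρ x) :=
  Function.bijective_iff_has_inverse.mpr ⟨(α (x, x⁻¹) • ρ x⁻¹ : Module.End ℂ V),
    fun v => congr($(h.inv_mul_eq x) v), fun v => congr($(h.mul_inv_eq x) v)⟩

theorem mul_eq_of_commute (h : IsProjRep α ρ) {x y : G} (hxy : x * y = y * x) :
    ρ y * ρ x = commPairing α x y • (ρ x * ρ y) := by
  rw [h.mul_eq, h.mul_eq, hxy, smul_smul, commPairing]
  congr 1
  rw [mul_right_comm, mul_inv_cancel, one_mul]

/-- The operators of an irreducible projective representation span `End V`. -/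
theorem span_range_eq_top (h : IsProjRep α ρ) [FiniteDimensional ℂ V] [Nontrivial V]
    (hirr : ∀ W : Submodule ℂ V, (∀ (g : G), ∀ v ∈ W, ρ g v ∈ W) → W = ⊥ ∨ W = ⊤) :
    Submodule.span ℂ (Set.range ρ) = ⊤ := by
  let A := (Submodule.span ℂ (Set.range ρ)).toSubalgebra
    (Submodule.subset_span ⟨1, h.map_one⟩) (fun x y hx hy => by
      have hxy := Submodule.mul_mem_mul hx hy
      rw [Submodule.span_mul_span] at hxy
      refine Submodule.span_le.mpr ?_ hxy
      rintro _ ⟨_, ⟨g, rfl⟩, _, ⟨k, rfl⟩, rfl⟩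
      change ρ g * ρ k ∈ _
      rw [h.mul_eq]
      exact Submodule.smul_mem _ _ (Submodule.subset_span ⟨_, rfl⟩))
  have hA : A = ⊤ := A.eq_top_of_irreducible fun W hW =>
    hirr W fun g v hv => hW (ρ g) (Submodule.subset_span ⟨g, rfl⟩) v hv
  refine eq_top_iff.mpr fun f _ => ?_
  have hf : f ∈ A := hA ▸ Algebra.mem_top
  exact hf

omit [Group G] in
/-- An operator commuting with an irreducible projective representation is a scalar. -/
theorem exists_smul_one_of_commute (hspan : Submodule.span ℂ (Set.range ρ) = ⊤)
    {T : Module.End ℂ V} (hT : ∀ g, ρ g * T = T * ρ g) : ∃ c : ℂ, T = c • 1 := by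
  have hc : T ∈ Set.center (Module.End ℂ V) := by
    rw [Semigroup.mem_center_iff]
    intro f
    have hf : f ∈ Submodule.span ℂ (Set.range ρ) := hspan ▸ Submodule.mem_top
    induction hf using Submodule.span_induction with
    | mem _ hx => obtain ⟨g, rfl⟩ := hx; exact hT g
    | zero => simp
    | add _ _ _ _ hx hy => rw [add_mul, mul_add, hx, hy]
    | smul c _ _ hx => rw [smul_mul_assoc, mul_smul_comm, hx]
  obtain ⟨c, _, rfl⟩ := Module.End.mem_center_iff.mp hc
  exact ⟨c, LinearMap.ext fun v => by simp⟩

/-- If `x` pairs trivially with its centralizer, then averaging `ρ x` over conjugation gives an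
operator commuting with the representation, in which the coefficient of `ρ x` is positive. -/
theorem exists_commPairing_ne_one (h : IsProjRep α ρ) [Fintype G] [FiniteDimensional ℂ V]
    (hspan : Submodule.span ℂ (Set.range ρ) = ⊤) (hli : LinearIndependent ℂ ρ)
    {x : G} (hx : x ≠ 1) : ∃ y, x * y = y * x ∧ commPairing α x y ≠ 1 := by
  classical
  by_contra! hcon
  set σ : G → Module.End ℂ V := fun g => α (g, g⁻¹) • ρ g⁻¹ with hσ
  have hσr : ∀ g, ρ g * σ g = 1 := h.mul_inv_eq
  have hσl : ∀ g, σ g * ρ g = 1 := h.inv_mul_eq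
  have hconj : ∀ g, ∃ c : ℂ, ρ g * ρ x * σ g = c • ρ (g * x * g⁻¹) := fun g =>
    ⟨(((α (g, x))⁻¹ * α (g, g⁻¹) * (α (g * x, g⁻¹))⁻¹ : ℂˣ) : ℂ), by
      rw [h.mul_eq, hσ, smul_mul_assoc, mul_smul_comm, h.mul_eq, smul_smul, smul_smul,
        Units.smul_def]⟩
  have hfix : ∀ g, x * g = g * x → ρ g * ρ x * σ g = ρ x := fun g hg => by
    rw [h.mul_eq_of_commute hg, hcon g hg, one_smul, mul_assoc, hσr, mul_one]
  choose c hc using hconj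
  clear_value σ
  set T : Module.End ℂ V := ∑ g, ρ g * ρ x * σ g with hTdef
  have hT : ∀ k, ρ k * T = T * ρ k := fun k => by
    have key : ∀ g, ρ k * (ρ g * ρ x * σ g) = (ρ (k * g) * ρ x * σ (k * g)) * ρ k := fun g => by
      have h1 : σ (k * g) * ρ k = ((α (k, g))⁻¹ : ℂˣ) • σ g := by
        calc σ (k * g) * ρ k = σ (k * g) * ρ k * (ρ g * σ g) := by rw [hσr, mul_one]
          _ = σ (k * g) * (ρ k * ρ g) * σ g := by simp only [mul_assoc]
          _ = _ := by rw [h.mul_eq, mul_smul_comm, hσl, smul_mul_assoc, one_mul]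
      rw [mul_assoc _ _ (ρ k), h1, h.map_mul, ← Units.smul_def]
      simp only [smul_mul_assoc, mul_smul_comm, smul_smul, inv_mul_cancel, one_smul, mul_assoc]
    rw [hTdef, Finset.mul_sum, Finset.sum_mul]
    simp_rw [key]
    exact Fintype.sum_equiv (Equiv.mulLeft k) _ _ fun g => rfl
  obtain ⟨z, hz⟩ := exists_smul_one_of_commute hspan hT
  have hsum : ∑ y, (∑ g with g * x * g⁻¹ = y, c g) • ρ y = ∑ y, (if y = 1 then z else 0) • ρ y := by
    have h1 : ∑ y, (if y = 1 then z else 0) • ρ y = T := by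
      simp [ite_smul, hz, h.map_one]
    rw [h1, hTdef]
    refine Eq.trans ?_ (Finset.sum_fiberwise Finset.univ (fun g => g * x * g⁻¹) _)
    refine Finset.sum_congr rfl fun y _ => ?_
    rw [Finset.sum_smul]
    refine Finset.sum_congr rfl fun g hg => ?_
    rw [hc, (Finset.mem_filter.mp hg).2]
  have hcoef := Fintype.linearIndependent_iffₛ.mp hli _ _ hsum x
  have hρx : ρ x ≠ 0 := hli.ne_zero x
  have hone : ∀ g ∈ Finset.univ.filter (fun g => g * x * g⁻¹ = x), c g = 1 := fun g hg => by
    have hg' : g * x * g⁻¹ = x := (Finset.mem_filter.mp hg).2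
    have hcomm : x * g = g * x := (mul_inv_eq_iff_eq_mul.mp hg').symm
    have := hc g
    rw [hfix g hcomm, hg'] at this
    exact smul_left_injective ℂ hρx (by simpa using this.symm)
  rw [if_neg hx, Finset.sum_congr rfl hone, Finset.sum_const, nsmul_one, Nat.cast_eq_zero,
    Finset.card_eq_zero, Finset.filter_eq_empty_iff] at hcoef
  exact hcoef (Finset.mem_univ 1) (by simp)

theorem trace_eq_zero (h : IsProjRep α ρ) [FiniteDimensional ℂ V] {x y : G}
    (hxy : x * y = y * x) (hne : commPairing α x y ≠ 1) : LinearMap.trace ℂ V (ρ x) = 0 := by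
  have h1 : ρ y * ρ x * (α (y, y⁻¹) • ρ y⁻¹) = (commPairing α x y : ℂ) • ρ x := by
    rw [h.mul_eq_of_commute hxy, smul_mul_assoc, mul_assoc, h.mul_inv_eq, mul_one,
      Units.smul_def]
  have h2 := congr(LinearMap.trace ℂ V $h1)
  rw [mul_assoc, LinearMap.trace_mul_comm, mul_assoc, h.inv_mul_eq, mul_one, map_smul,
    smul_eq_mul] at h2
  by_contra h3
  exact hne (Units.ext (by simpa using (mul_right_cancel₀ h3 ((one_mul _).trans h2)).symm))

theorem linearIndependent (h : IsProjRep α ρ) [Fintype G] [FiniteDimensional ℂ V] [Nontrivial V]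
    (hα : ∀ x : G, x ≠ 1 → ∃ y, x * y = y * x ∧ commPairing α x y ≠ 1) :
    LinearIndependent ℂ ρ := by
  have htr : ∀ x, x ≠ 1 → LinearMap.trace ℂ V (ρ x) = 0 := fun x hx => by
    obtain ⟨y, hxy, hne⟩ := hα x hx
    exact h.trace_eq_zero hxy hne
  refine Fintype.linearIndependent_iff.mpr fun c hc k => ?_
  have h1 := congr(LinearMap.trace ℂ V ($hc * (α (k, k⁻¹) • ρ k⁻¹)))
  rw [zero_mul, map_zero, Finset.sum_mul, map_sum, Finset.sum_eq_single k] at h1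
  · rw [smul_mul_assoc, h.mul_inv_eq, map_smul, LinearMap.trace_one, smul_eq_mul] at h1
    exact (mul_eq_zero.mp h1).resolve_right (by exact_mod_cast Module.finrank_pos.ne')
  · intro g _ hg
    rw [smul_mul_assoc, mul_smul_comm, h.mul_eq, map_smul, Units.smul_def, map_smul,
      Units.smul_def, map_smul, htr _ (mul_inv_eq_one.not.mpr hg)]
    simp
  · simp

end IsProjRep

/-- The twisted regular representation. -/
noncomputable def twistedRegular (α : G × G → ℂˣ) (x : G) : Module.End ℂ (G → ℂ) where
  toFun f h := ((α (h, x))⁻¹ : ℂˣ) * f (h * x)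
  map_add' f g := by ext; simp [mul_add]
  map_smul' c f := by ext; simp [mul_left_comm]

theorem isProjRep_twistedRegular {α : G × G → ℂˣ} (hα : IsMul2Cocycle α) :
    IsProjRep α (twistedRegular α) where
  map_one := by
    ext f h
    simp [twistedRegular, hα.one_right]
  map_mul x y := by
    refine LinearMap.ext fun f => funext fun h => ?_
    have h1 : (α (h, x * y))⁻¹ = α (x, y) * ((α (h, x))⁻¹ * (α (h * x, y))⁻¹) := by
      rw [← mul_inv, hα.2 h x y, mul_inv, mul_left_comm, mul_inv_cancel, mul_one]
    change (((α (h, x * y))⁻¹ : ℂˣ) : ℂ) * f (h * (x * y)) =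
      α (x, y) * (((α (h, x))⁻¹ : ℂˣ) * (((α (h * x, y))⁻¹ : ℂˣ) * f (h * x * y)))
    rw [h1, mul_assoc h x y]
    push_cast
    ring

theorem exists_irreducible_projRep [Finite G] {α : G × G → ℂˣ} (hα : IsMul2Cocycle α) :
    ∃ (V : Type) (_ : AddCommGroup V) (_ : Module ℂ V) (ρ : G → Module.End ℂ V),
      FiniteDimensional ℂ V ∧ Nontrivial V ∧ IsProjRep α ρ ∧
      ∀ W : Submodule ℂ V, (∀ (g : G), ∀ v ∈ W, ρ g v ∈ W) → W = ⊥ ∨ W = ⊤ := by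
  have hreg := isProjRep_twistedRegular hα
  obtain ⟨W, ⟨hW0, hWinv⟩, hmin⟩ := wellFounded_lt.has_min
    {W : Submodule ℂ (G → ℂ) | W ≠ ⊥ ∧ ∀ g, ∀ v ∈ W, twistedRegular α g v ∈ W}
    ⟨⊤, top_ne_bot, fun _ _ _ => Submodule.mem_top⟩
  refine ⟨W, inferInstance, inferInstance,
    fun g => (twistedRegular α g).restrict (hWinv g), inferInstance,
    Submodule.nontrivial_iff_ne_bot.mpr hW0, ⟨?_, fun x y => ?_⟩, fun U hU => ?_⟩
  · ext v : 2
    simp [hreg.map_one]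
  · ext v : 2
    simp [hreg.map_mul]
  · by_cases hU0 : U = ⊥
    · exact Or.inl hU0
    right
    have hmem : U.map W.subtype ∈
        {W : Submodule ℂ (G → ℂ) | W ≠ ⊥ ∧ ∀ g, ∀ v ∈ W, twistedRegular α g v ∈ W} := by
      refine ⟨fun h => hU0 ?_, ?_⟩
      · exact Submodule.map_injective_of_injective W.injective_subtype
          (h.trans (Submodule.map_bot _).symm)
      · rintro g _ ⟨v, hv, rfl⟩
        exact ⟨_, hU g v hv, rfl⟩
    have hle : U.map W.subtype ≤ W := Submodule.map_subtype_le W U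
    have heq : U.map W.subtype = W := hle.eq_of_not_lt (hmin _ hmem)
    refine eq_top_iff.mpr fun v _ => ?_
    have hv : (v : G → ℂ) ∈ U.map W.subtype := heq.symm ▸ v.2
    obtain ⟨u, hu, huv⟩ := hv
    exact (Subtype.ext huv : u = v) ▸ hu

/-- A cocycle is non-degenerate if and only if no `x ≠ 1` pairs trivially with its whole
centralizer. -/
theorem isNonDegenerate_iff [Finite G] {α : G × G → ℂˣ} (hα : IsMul2Cocycle α) :
    IsNonDegenerate α ↔ ∀ x : G, x ≠ 1 → ∃ y, x * y = y * x ∧ commPairing α x y ≠ 1 := by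
  have := Fintype.ofFinite G
  constructor
  · rintro ⟨V, _, _, ρ, hfd, hnt, hone, hmul, -, hirr, hdim⟩ x hx
    have hρ : IsProjRep α (V := V) ρ := ⟨hone, hmul⟩
    have hspan := hρ.span_range_eq_top hirr
    refine hρ.exists_commPairing_ne_one hspan
      (linearIndependent_of_top_le_span_of_card_eq_finrank hspan.ge ?_) hx
    rw [Module.finrank_linearMap, ← sq, hdim, Nat.card_eq_fintype_card]
  · intro h
    obtain ⟨V, _, _, ρ, hfd, hnt, hρ, hirr⟩ := exists_irreducible_projRep hα
    refine ⟨V, inferInstance, inferInstance, ρ, hfd, hnt, hρ.map_one, hρ.map_mul,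
      hρ.bijective, hirr, ?_⟩
    have hli := hρ.linearIndependent h
    have hspan := hρ.span_range_eq_top hirr
    rw [Nat.card_eq_fintype_card, linearIndependent_iff_card_eq_finrank_span.mp hli,
      Set.finrank, hspan, finrank_top, Module.finrank_linearMap, sq]

end ProjectiveRepresentations
section Splitting

open scoped commutatorElement

theorem commutatorElement_mul_left_of_center {E : Type*} [Group E]
    (hE : ∀ x y : E, ⁅x, y⁆ ∈ Subgroup.center E) (x y z : E) : ⁅x * y, z⁆ = ⁅x, z⁆ * ⁅y, z⁆ := by
  have h := Subgroup.mem_center_iff.mp (hE y z)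
  calc ⁅x * y, z⁆ = x * ⁅y, z⁆ * x⁻¹ * ⁅x, z⁆ := by simp only [commutatorElement_def]; group
    _ = ⁅y, z⁆ * ⁅x, z⁆ := by rw [h x, mul_inv_cancel_right]
    _ = ⁅x, z⁆ * ⁅y, z⁆ := (h _).symm

namespace Heisenberg

variable {R : Type*} [CommRing R]

theorem eq_mul (x : Heisenberg R) :
    x = (⟨x.a, 0, 0⟩ * ⟨0, x.b, 0⟩ : Heisenberg R) * ⟨0, 0, x.c⟩ := by
  ext <;> simp

theorem mul_comm_iff {x y : Heisenberg R} : x * y = y * x ↔ x.b * y.a = y.b * x.a := by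
  refine ⟨fun h => ?_, fun h => ?_⟩
  · have := congrArg Heisenberg.c h
    simp only [mul_c] at this
    linear_combination this
  · ext
    · simp [add_comm]
    · simp [add_comm]
    · simp only [mul_c]
      linear_combination h

theorem pow_eq {x : Heisenberg R} (hx : x.b * x.a = 0) (n : ℕ) :
    x ^ n = ⟨n * x.a, n * x.b, n * x.c⟩ := by
  induction n with
  | zero => ext <;> simp
  | succ n ih =>
    rw [pow_succ, ih]
    ext
    · simp [add_mul]
    · simp [add_mul]
    · simp only [mul_c]
      push_cast
      linear_combination (n : R) * hx

section Pairing

variable {α : Heisenberg R × Heisenberg R → ℂˣ}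

theorem commPairing_center_center (hα : IsMul2Cocycle α) (z w : R) :
    commPairing α (⟨0, 0, z⟩ : Heisenberg R) ⟨0, 0, w⟩ = 1 := by
  have h1 : ∀ g : Heisenberg R, (⟨0, 0, z⟩ : Heisenberg R) * g = g * ⟨0, 0, z⟩ := fun g => by
    rw [mul_comm_iff]; simp
  have h : (⟨0, w, 0⟩ * ⟨1, 0, 0⟩ : Heisenberg R) = ⟨1, 0, 0⟩ * ⟨0, w, 0⟩ * ⟨0, 0, w⟩ := by
    ext <;> simp
  have h2 := congrArg (commPairing α (⟨0, 0, z⟩ : Heisenberg R)) h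
  rw [hα.commPairing_mul_right (h1 _) (h1 _), hα.commPairing_mul_right (h1 _) (h1 _),
    hα.commPairing_mul_right (h1 _) (h1 _), mul_comm] at h2
  exact mul_eq_left.mp h2.symm

/-- The Jacobi identity for the pairing between the centre and the group: if `x`, `y` commute and
`g` conjugates them to `x z`, `y w` with `z`, `w` central, then the extra terms cancel. -/
theorem commPairing_jacobi (hα : IsMul2Cocycle α) {g x y : Heisenberg R} {z w : R}
    (hxy : x * y = y * x) (hx : g * x = x * ⟨0, 0, z⟩ * g) (hy : g * y = y * ⟨0, 0, w⟩ * g) :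
    commPairing α (⟨0, 0, z⟩ : Heisenberg R) y = commPairing α ⟨0, 0, w⟩ x := by
  have hc : ∀ (u : R) (k : Heisenberg R), (⟨0, 0, u⟩ : Heisenberg R) * k = k * ⟨0, 0, u⟩ :=
    fun u k => by rw [mul_comm_iff]; simp
  have h := hα.commPairing_conj hxy hx hy
  have h1 : x * (y * ⟨0, 0, w⟩) = y * ⟨0, 0, w⟩ * x := by
    rw [mul_assoc y, hc, ← mul_assoc, ← mul_assoc, hxy]
  rw [hα.commPairing_mul_left h1 (hc _ _), hα.commPairing_mul_right hxy (hc _ _).symm,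
    hα.commPairing_mul_right (hc _ _) (hc _ _), commPairing_center_center hα, mul_one,
    mul_assoc, mul_eq_left, commPairing_swap α _ x] at h
  exact (inv_mul_eq_one.mp h).symm

theorem commPairing_center_a (hα : IsMul2Cocycle α) (z a : R) :
    commPairing α (⟨0, 0, z⟩ : Heisenberg R) ⟨a, 0, 0⟩ =
      commPairing α (⟨0, 0, 1⟩ : Heisenberg R) ⟨z * a, 0, 0⟩ := by
  have key : ∀ b a a' : R, commPairing α (⟨0, 0, b * a⟩ : Heisenberg R) ⟨a', 0, 0⟩ =
      commPairing α (⟨0, 0, b * a'⟩ : Heisenberg R) ⟨a, 0, 0⟩ := fun b a a' =>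
    commPairing_jacobi hα (g := ⟨0, b, 0⟩) (by rw [mul_comm_iff]; simp)
      (by ext <;> simp) (by ext <;> simp)
  have h1 := key z 1 a
  have h2 := key 1 1 (z * a)
  rw [mul_one] at h1 h2
  rw [h1, h2, one_mul]

theorem commPairing_center_b (hα : IsMul2Cocycle α) (z b : R) :
    commPairing α (⟨0, 0, z⟩ : Heisenberg R) ⟨0, b, 0⟩ =
      commPairing α (⟨0, 0, 1⟩ : Heisenberg R) ⟨0, z * b, 0⟩ := by
  have key : ∀ a b b' : R, commPairing α (⟨0, 0, -(b * a)⟩ : Heisenberg R) ⟨0, b', 0⟩ =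
      commPairing α (⟨0, 0, -(b' * a)⟩ : Heisenberg R) ⟨0, b, 0⟩ := fun a b b' =>
    commPairing_jacobi hα (g := ⟨a, 0, 0⟩) (by rw [mul_comm_iff]; simp)
      (by ext <;> simp) (by ext <;> simp)
  have h1 := key (-z) 1 b
  have h2 := key (-1) 1 (z * b)
  simp only [one_mul, neg_neg, mul_neg, mul_one] at h1 h2
  rw [h1, h2, mul_comm b z]

end Pairing

/-- The values of the commutator pairing which determine the cohomology class of a cocycle of
`H₃(R)` when `R` is additively generated by `1` and `t` with `t² = 0`. -/
noncomputable def invariants (t : R) (α : Heisenberg R × Heisenberg R → ℂˣ) : Fin 8 → ℂˣ :=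
  ![commPairing α ⟨0, 0, 1⟩ ⟨1, 0, 0⟩, commPairing α ⟨0, 0, 1⟩ ⟨t, 0, 0⟩,
    commPairing α ⟨0, 0, 1⟩ ⟨0, 1, 0⟩, commPairing α ⟨0, 0, 1⟩ ⟨0, t, 0⟩,
    commPairing α ⟨1, 0, 0⟩ ⟨t, 0, 0⟩, commPairing α ⟨0, 1, 0⟩ ⟨0, t, 0⟩,
    commPairing α ⟨t, 0, 0⟩ ⟨0, t, 0⟩, commPairing α ⟨1, 1, 0⟩ ⟨t, t, 0⟩]

theorem isMul2Coboundary_of_invariants {t : R} (ht : t * t = 0)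
    (hR : ∀ P : R → Prop, P 0 → P 1 → P t → (∀ r s, P r → P s → P (r + s)) → ∀ r, P r)
    (α : mul2Cocycles (Heisenberg R)) (hinv : invariants t α.1 = 1) :
    IsMul2Coboundary α.1 := by
  have hα : IsMul2Cocycle α.1 := α.2
  have h0 : commPairing α.1 ⟨0, 0, 1⟩ ⟨1, 0, 0⟩ = 1 := congrFun hinv 0
  have h1 : commPairing α.1 ⟨0, 0, 1⟩ ⟨t, 0, 0⟩ = 1 := congrFun hinv 1
  have h2 : commPairing α.1 ⟨0, 0, 1⟩ ⟨0, 1, 0⟩ = 1 := congrFun hinv 2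
  have h3 : commPairing α.1 ⟨0, 0, 1⟩ ⟨0, t, 0⟩ = 1 := congrFun hinv 3
  have h4 : commPairing α.1 ⟨1, 0, 0⟩ ⟨t, 0, 0⟩ = 1 := congrFun hinv 4
  have h5 : commPairing α.1 ⟨0, 1, 0⟩ ⟨0, t, 0⟩ = 1 := congrFun hinv 5
  have h6 : commPairing α.1 ⟨t, 0, 0⟩ ⟨0, t, 0⟩ = 1 := congrFun hinv 6
  have h7 : commPairing α.1 ⟨1, 1, 0⟩ ⟨t, t, 0⟩ = 1 := congrFun hinv 7
  have hc : ∀ (u : R) (k : Heisenberg R), (⟨0, 0, u⟩ : Heisenberg R) * k = k * ⟨0, 0, u⟩ :=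
    fun u k => by rw [mul_comm_iff]; simp
  have hzero : (⟨0, 0, 0⟩ : Heisenberg R) = 1 := rfl
  have hadd_a : ∀ r s : R, (⟨r + s, 0, 0⟩ : Heisenberg R) = ⟨r, 0, 0⟩ * ⟨s, 0, 0⟩ :=
    fun r s => by ext <;> simp
  have hadd_b : ∀ r s : R, (⟨0, r + s, 0⟩ : Heisenberg R) = ⟨0, r, 0⟩ * ⟨0, s, 0⟩ :=
    fun r s => by ext <;> simp
  have hZa : ∀ z a : R, commPairing α.1 ⟨0, 0, z⟩ ⟨a, 0, 0⟩ = 1 := fun z a => by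
    rw [commPairing_center_a hα]
    refine hR (fun r => commPairing α.1 ⟨0, 0, 1⟩ ⟨r, 0, 0⟩ = 1)
      (hα.commPairing_one_right _) h0 h1 (fun r s hr hs => ?_) _
    rw [hadd_a, hα.commPairing_mul_right (hc _ _) (hc _ _), hr, hs, one_mul]
  have hZb : ∀ z b : R, commPairing α.1 ⟨0, 0, z⟩ ⟨0, b, 0⟩ = 1 := fun z b => by
    rw [commPairing_center_b hα]
    refine hR (fun r => commPairing α.1 ⟨0, 0, 1⟩ ⟨0, r, 0⟩ = 1)
      (hα.commPairing_one_right _) h2 h3 (fun r s hr hs => ?_) _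
    rw [hadd_b, hα.commPairing_mul_right (hc _ _) (hc _ _), hr, hs, one_mul]
  have hZ : ∀ (z : R) (g : Heisenberg R), commPairing α.1 ⟨0, 0, z⟩ g = 1 := fun z g => by
    rw [eq_mul g, hα.commPairing_mul_right (hc _ _) (hc _ _),
      hα.commPairing_mul_right (hc _ _) (hc _ _), hZa, hZb, commPairing_center_center hα]
    simp
  have hcentral : ∀ e : TwistedExtension α, e.base.a = 0 → e.base.b = 0 →
      e ∈ Subgroup.center (TwistedExtension α) := fun e ha hb => by
    have he : e.base = ⟨0, 0, e.base.c⟩ := by ext <;> simp [ha, hb]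
    refine Subgroup.mem_center_iff.mpr fun g => ?_
    have hcomm : e.base * g.base = g.base * e.base := by rw [he]; exact hc _ _
    rw [TwistedExtension.mul_eq_commPairing hcomm.symm, commPairing_swap, he, hZ, inv_one,
      map_one, one_mul]
  have hclass : ∀ x y : TwistedExtension α, ⁅x, y⁆ ∈ Subgroup.center (TwistedExtension α) :=
    fun x y => hcentral _ (by simp [commutatorElement_def]) (by simp [commutatorElement_def])
  let K : Heisenberg R → Heisenberg R → TwistedExtension α := fun x y =>
    ⁅(TwistedExtension.lift x : TwistedExtension α), TwistedExtension.lift y⁆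
  have hmem : ∀ s, TwistedExtension.ofScalar s ∈ Subgroup.center (TwistedExtension α) := fun s =>
    Subgroup.mem_center_iff.mpr fun g => (TwistedExtension.ofScalar_comm s g).symm
  have hcl : ∀ e ∈ Subgroup.center (TwistedExtension α),
      ∀ g : TwistedExtension α, ⁅e, g⁆ = 1 := fun e he g =>
    commutatorElement_eq_one_iff_mul_comm.mpr (Subgroup.mem_center_iff.mp he g).symm
  have hKinv : ∀ x y, (K x y)⁻¹ = K y x := fun x y => commutatorElement_inv _ _
  have hKmul : ∀ x y z, K (x * y) z = K x z * K y z := fun x y z => by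
    have := commutatorElement_mul_left_of_center hclass
    have h := congrArg (⁅·, (TwistedExtension.lift z : TwistedExtension α)⁆)
      (TwistedExtension.lift_mul_lift (α := α) x y)
    beta_reduce at h
    rw [this, this, hcl _ (hmem _), one_mul] at h
    exact h.symm
  have hKcomm : ∀ x y (g : TwistedExtension α), g * K x y = K x y * g := fun x y g =>
    Subgroup.mem_center_iff.mp (hclass _ _) g
  have hKmulr : ∀ x y z, K x (y * z) = K x y * K x z := fun x y z => by
    rw [← hKinv, hKmul, mul_inv_rev, hKinv, hKinv, hKcomm]
  have hKone : ∀ x y, x * y = y * x → commPairing α.1 x y = 1 → K x y = 1 := fun x y hxy h => by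
    refine commutatorElement_eq_one_iff_mul_comm.mpr ?_
    rw [TwistedExtension.mul_eq_commPairing (x := TwistedExtension.lift x)
      (y := TwistedExtension.lift y) hxy]
    simp [h]
  have hKswap : ∀ x y, K x y = 1 → K y x = 1 := fun x y h => by rw [← hKinv, h, inv_one]
  have hKl : ∀ x, K 1 x = 1 := fun x => hKone _ _ (by simp)
    (by rw [commPairing_swap, hα.commPairing_one_right, inv_one])
  have hKr : ∀ x, K x 1 = 1 := fun x => hKswap _ _ (hKl x)
  have hKself : ∀ x, K x x = 1 := fun x => hKone _ _ rfl (commPairing_self _ _)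
  have hKZ : ∀ z x, K ⟨0, 0, z⟩ x = 1 := fun z x => hKone _ _ (hc _ _) (hZ z x)
  have hKZ' : ∀ z x, K x ⟨0, 0, z⟩ = 1 := fun z x => hKswap _ _ (hKZ z x)
  have hAA : ∀ r s : R, K ⟨r, 0, 0⟩ ⟨s, 0, 0⟩ = 1 := fun r s => by
    have h1t : K ⟨1, 0, 0⟩ ⟨t, 0, 0⟩ = 1 := hKone _ _ (by rw [mul_comm_iff]; simp) h4
    refine hR (fun r => K ⟨r, 0, 0⟩ ⟨s, 0, 0⟩ = 1) (hKl _) ?_ ?_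
      (fun r s hr hs => by rw [hadd_a, hKmul, hr, hs, one_mul]) r
    · exact hR (fun s => K ⟨1, 0, 0⟩ ⟨s, 0, 0⟩ = 1) (hKr _) (hKself _) h1t
        (fun r s hr hs => by rw [hadd_a, hKmulr, hr, hs, one_mul]) s
    · exact hR (fun s => K ⟨t, 0, 0⟩ ⟨s, 0, 0⟩ = 1) (hKr _) (hKswap _ _ h1t) (hKself _)
        (fun r s hr hs => by rw [hadd_a, hKmulr, hr, hs, one_mul]) s
  have hBB : ∀ r s : R, K ⟨0, r, 0⟩ ⟨0, s, 0⟩ = 1 := fun r s => by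
    have h1t : K ⟨0, 1, 0⟩ ⟨0, t, 0⟩ = 1 := hKone _ _ (by rw [mul_comm_iff]; simp) h5
    refine hR (fun r => K ⟨0, r, 0⟩ ⟨0, s, 0⟩ = 1) (hKl _) ?_ ?_
      (fun r s hr hs => by rw [hadd_b, hKmul, hr, hs, one_mul]) r
    · exact hR (fun s => K ⟨0, 1, 0⟩ ⟨0, s, 0⟩ = 1) (hKr _) (hKself _) h1t
        (fun r s hr hs => by rw [hadd_b, hKmulr, hr, hs, one_mul]) s
    · exact hR (fun s => K ⟨0, t, 0⟩ ⟨0, s, 0⟩ = 1) (hKr _) (hKswap _ _ h1t) (hKself _)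
        (fun r s hr hs => by rw [hadd_b, hKmulr, hr, hs, one_mul]) s
  have hexp : ∀ x y : Heisenberg R, K x y =
      (K ⟨0, y.b, 0⟩ ⟨x.a, 0, 0⟩)⁻¹ * K ⟨0, x.b, 0⟩ ⟨y.a, 0, 0⟩ := fun x y => by
    rw [hKinv]
    conv_lhs => rw [eq_mul x, eq_mul y]
    simp only [hKmul, hKmulr, hKZ, hKZ', hAA, hBB, one_mul, mul_one]
  have hbal1 : K ⟨0, 1, 0⟩ ⟨t, 0, 0⟩ = K ⟨0, t, 0⟩ ⟨1, 0, 0⟩ := by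
    have h := hKone ⟨1, 1, 0⟩ ⟨t, t, 0⟩ (by rw [mul_comm_iff]; ring) h7
    rw [hexp] at h
    exact (inv_mul_eq_one.mp h).symm
  have hbal : ∀ b a : R, K ⟨0, b, 0⟩ ⟨a, 0, 0⟩ = K ⟨0, b * a, 0⟩ ⟨1, 0, 0⟩ := fun b a => by
    refine hR (fun a => K ⟨0, b, 0⟩ ⟨a, 0, 0⟩ = K ⟨0, b * a, 0⟩ ⟨1, 0, 0⟩) ?_ ?_ ?_
      (fun r s hr hs => by rw [hadd_a, hKmulr, hr, hs, mul_add, hadd_b, hKmul]) a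
    · rw [mul_zero, hzero, hKr, hKl]
    · rw [mul_one]
    · refine hR (fun b => K ⟨0, b, 0⟩ ⟨t, 0, 0⟩ = K ⟨0, b * t, 0⟩ ⟨1, 0, 0⟩) ?_ ?_ ?_
        (fun r s hr hs => by rw [hadd_b, hKmul, hr, hs, add_mul, hadd_b, hKmul]) b
      · rw [zero_mul, hzero, hKl, hKl]
      · rw [one_mul, hbal1]
      · rw [ht, hzero, hKl]
        exact hKswap _ _ (hKone _ _ (by rw [mul_comm_iff]; simp [ht]) h6)
  let h : Multiplicative R →* TwistedExtension α :=
    { toFun := fun r => K ⟨0, r.toAdd, 0⟩ ⟨1, 0, 0⟩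
      map_one' := hKl _
      map_mul' := fun r s => by rw [← hKmul, ← hadd_b]; rfl }
  have hnormal : h.range.Normal := ⟨by
    rintro _ ⟨r, rfl⟩ g
    have : g * h r = h r * g := hKcomm _ _ g
    rw [this, mul_inv_cancel_right]
    exact ⟨r, rfl⟩⟩
  refine TwistedExtension.isMul2Coboundary_of_quotient h.range (fun x y => ?_) fun s hs => ?_
  · have hxy : ⁅x, y⁆ = K x.base y.base := by
      have hm := commutatorElement_mul_left_of_center hclass
      have hl : ∀ x y : TwistedExtension α,
          ⁅x, y⁆ = ⁅(TwistedExtension.lift x.base : TwistedExtension α), y⁆ := by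
        intro x y
        conv_lhs => rw [TwistedExtension.eq_ofScalar_mul_lift x]
        rw [hm, hcl _ (hmem _), one_mul]
      rw [hl x y, ← commutatorElement_inv, hl y, commutatorElement_inv]
    rw [hxy, hexp, hbal y.base.b, hbal x.base.b]
    exact mul_mem (inv_mem ⟨Multiplicative.ofAdd (y.base.b * x.base.a), rfl⟩)
      ⟨Multiplicative.ofAdd (x.base.b * y.base.a), rfl⟩
  · obtain ⟨r, hr⟩ := hs
    have hr0 : r.toAdd = 0 := by
      have := congrArg (fun e : TwistedExtension α => e.base.c) hr
      simpa [h, K, commutatorElement_def] using this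
    have hr1 : r = 1 := hr0
    rw [hr1, map_one] at hr
    exact TwistedExtension.ofScalar_injective (hr.symm.trans (map_one _).symm)

end Heisenberg

end Splitting

section DualNumbers

open DualNumber

/-- Parameters for the explicit cocycles of `H₃(F[ε])`. -/
@[ext]
structure CocycleParam (F : Type*) where
  (u₀ u₁ v₀ v₁ m n q r : F)

namespace CocycleParam

variable {F : Type*} [Field F]

/-- The quadratic expression in the parameters which detects non-degeneracy. -/
def disc (P : CocycleParam F) : F :=
  P.m * P.v₀ ^ 2 + P.n * P.u₀ ^ 2 + P.q * (P.v₀ * P.u₁ - P.v₁ * P.u₀) - P.r * P.v₀ * P.u₀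

/-- The parameters of non-degenerate cocycles. -/
def IsGood (P : CocycleParam F) : Prop := (P.u₀, P.v₀) ≠ 0 ∧ P.disc ≠ 0

open Classical in
/-- Good parameters correspond freely to `(u₀, v₀) ≠ 0`, a nonzero value of `disc` and five further
parameters. -/
noncomputable def goodEquiv :
    {P : CocycleParam F // P.IsGood} ≃ {w : F × F // w ≠ 0} × Fˣ × F × F × F × F × F where
  toFun P := (⟨(P.1.u₀, P.1.v₀), P.2.1⟩, Units.mk0 P.1.disc P.2.2, P.1.u₁, P.1.v₁, P.1.q, P.1.r,
    if P.1.v₀ = 0 then P.1.m else P.1.n)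
  invFun := fun ⟨⟨(u₀, v₀), hw⟩, d, u₁, v₁, q, r, s⟩ =>
    ⟨if v₀ = 0 then ⟨u₀, u₁, v₀, v₁, s, (d + q * v₁ * u₀) / u₀ ^ 2, q, r⟩
      else ⟨u₀, u₁, v₀, v₁,
        (d - s * u₀ ^ 2 - q * (v₀ * u₁ - v₁ * u₀) + r * v₀ * u₀) / v₀ ^ 2, s, q, r⟩, by
      by_cases h : v₀ = 0
      · have hu : u₀ ≠ 0 := fun hu => hw (by rw [h, hu]; rfl)
        rw [if_pos h]
        refine ⟨hw, ?_⟩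
        have : disc ⟨u₀, u₁, v₀, v₁, s, (d + q * v₁ * u₀) / u₀ ^ 2, q, r⟩ = d := by
          simp only [disc, h]
          field_simp
          ring
        rw [this]
        exact d.ne_zero
      · rw [if_neg h]
        refine ⟨hw, ?_⟩
        have : disc ⟨u₀, u₁, v₀, v₁,
            (d - s * u₀ ^ 2 - q * (v₀ * u₁ - v₁ * u₀) + r * v₀ * u₀) / v₀ ^ 2, s, q, r⟩ = d := by
          simp only [disc]
          field_simp
          ring
        rw [this]
        exact d.ne_zero⟩
  left_inv := by
    rintro ⟨⟨u₀, u₁, v₀, v₁, m, n, q, r⟩, hw, hd⟩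
    apply Subtype.ext
    by_cases h : v₀ = 0
    · have hu : u₀ ≠ 0 := fun hu => hw (by simp only [h, hu]; rfl)
      simp only [disc, h, if_true, Units.val_mk0]
      congr 1
      field_simp
      ring
    · simp only [disc, h, if_false, Units.val_mk0]
      congr 1
      field_simp
      ring
  right_inv := by
    rintro ⟨⟨⟨u₀, v₀⟩, hw⟩, d, u₁, v₁, q, r, s⟩
    by_cases h : v₀ = 0
    · have hu : u₀ ≠ 0 := fun hu => hw (by simp only [h, hu]; rfl)
      simp only [disc, h, if_true, Prod.mk.injEq, true_and, and_true]
      ext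
      simp only [Units.val_mk0]
      field_simp
      ring
    · simp only [disc, h, if_false, Prod.mk.injEq, true_and, and_true]
      ext
      simp only [Units.val_mk0]
      field_simp
      ring

theorem card_good [Finite F] : Nat.card {P : CocycleParam F // P.IsGood} =
    Nat.card F ^ 5 * (Nat.card F - 1) ^ 2 * (Nat.card F + 1) := by
  have hu : Nat.card Fˣ = Nat.card F - 1 := Nat.card_units F
  have hw : Nat.card {w : F × F // w ≠ 0} = Nat.card F ^ 2 - 1 := by
    have := Fintype.ofFinite F
    classical
    rw [Nat.card_eq_fintype_card, Fintype.card_subtype_compl, Fintype.card_subtype_eq,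
      Fintype.card_prod, Nat.card_eq_fintype_card, sq]
  have hsq : Nat.card F ^ 2 - 1 = (Nat.card F + 1) * (Nat.card F - 1) := by
    simpa using Nat.sq_sub_sq (Nat.card F) 1
  rw [Nat.card_congr goodEquiv]
  simp only [Nat.card_prod, hu, hw, hsq]
  ring

theorem exists_coords_of_mul_eq_zero {u₀ u₁ v₀ v₁ a₀ a₁ b₀ b₁ : F} (hw : (u₀, v₀) ≠ 0)
    (h₀ : u₀ * a₀ + v₀ * b₀ = 0) (h₁ : u₀ * a₁ + u₁ * a₀ + v₀ * b₁ + v₁ * b₀ = 0) :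
    ∃ r₀ r₁ : F, a₀ = -(r₀ * v₀) ∧ b₀ = r₀ * u₀ ∧ a₁ = -(r₀ * v₁ + r₁ * v₀) ∧
      b₁ = r₀ * u₁ + r₁ * u₀ := by
  by_cases hv : v₀ = 0
  · have hu : u₀ ≠ 0 := fun hu => hw (by rw [hv, hu]; rfl)
    subst hv
    have ha : a₀ = 0 := by simpa [hu] using h₀
    subst ha
    refine ⟨b₀ / u₀, (b₁ - b₀ / u₀ * u₁) / u₀, ?_, ?_, ?_, ?_⟩
    · simp
    · field_simp
    · field_simp
      linear_combination u₀ * h₁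
    · field_simp
      ring
  · refine ⟨-a₀ / v₀, -(a₁ - a₀ / v₀ * v₁) / v₀, ?_, ?_, ?_, ?_⟩
    · field_simp
    · field_simp
      linear_combination h₀
    · field_simp
      ring
    · field_simp
      linear_combination v₀ * h₁ - v₁ * h₀

end CocycleParam

namespace Heisenberg

variable {F : Type*} [Field F] {R : Type*} [CommRing R] (e : R ≃+* F[ε])

/-- The element of `R ≃ F[ε]` with the given coordinates. -/
def ofCoords (r s : F) : R := e.symm (TrivSqZeroExt.inl r + TrivSqZeroExt.inr s)

@[simp] theorem fst_ofCoords (r s : F) : (e (ofCoords e r s)).fst = r := by simp [ofCoords]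

@[simp] theorem snd_ofCoords (r s : F) : (e (ofCoords e r s)).snd = s := by simp [ofCoords]

theorem coords_ext {r s : R} (h₀ : (e r).fst = (e s).fst) (h₁ : (e r).snd = (e s).snd) : r = s :=
  e.injective (TrivSqZeroExt.ext h₀ h₁)

theorem commute_iff_coords {x y : Heisenberg R} : x * y = y * x ↔
    (e x.b).fst * (e y.a).fst = (e y.b).fst * (e x.a).fst ∧
    (e x.b).fst * (e y.a).snd + (e x.b).snd * (e y.a).fst =
      (e y.b).fst * (e x.a).snd + (e y.b).snd * (e x.a).fst := by
  rw [mul_comm_iff, ← e.injective.eq_iff, TrivSqZeroExt.ext_iff]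
  simp

/-- An explicit `F`-valued `2`-cocycle of `H₃(F[ε])`. -/
def form (P : CocycleParam F) (x y : Heisenberg R) : F :=
  P.u₀ * ((e x.c).fst * (e y.a).snd + (e x.c).snd * (e y.a).fst
      + 2⁻¹ * (e x.b).snd * (e y.a).fst ^ 2 + (e x.b).fst * (e y.a).fst * (e y.a).snd)
    + P.u₁ * ((e x.c).fst * (e y.a).fst + 2⁻¹ * (e x.b).fst * (e y.a).fst ^ 2)
    - P.v₀ * ((e x.b).fst * (e y.c).snd + (e x.b).snd * (e y.c).fst
      + 2⁻¹ * (e x.b).fst ^ 2 * (e y.a).snd + (e x.b).fst * (e x.b).snd * (e y.a).fst)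
    - P.v₁ * ((e x.b).fst * (e y.c).fst + 2⁻¹ * (e x.b).fst ^ 2 * (e y.a).fst)
    + P.m * (e x.a).fst * (e y.a).snd + P.n * (e x.b).fst * (e y.b).snd
    + P.q * (e x.a).snd * (e y.b).snd + P.r * (e x.a).fst * (e y.b).snd

variable {e} in
theorem form_cocycle (h2 : (2 : F) ≠ 0) (P : CocycleParam F) (x y z : Heisenberg R) :
    form e P x y + form e P (x * y) z = form e P x (y * z) + form e P y z := by
  have h : (2 : F) * 2⁻¹ = 1 := mul_inv_cancel₀ h2
  simp only [form, mul_a, mul_b, mul_c, map_add, map_mul, TrivSqZeroExt.fst_add,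
    TrivSqZeroExt.snd_add, TrivSqZeroExt.fst_mul, DualNumber.snd_mul]
  field_simp
  ring

/-- The explicit cocycle with values in `ℂˣ`. -/
def cocycle (ψ : AddChar F ℂˣ) (P : CocycleParam F) : Heisenberg R × Heisenberg R → ℂˣ :=
  fun x => ψ (form e P x.1 x.2)

theorem isMul2Cocycle_cocycle (h2 : (2 : F) ≠ 0) (ψ : AddChar F ℂˣ) (P : CocycleParam F) :
    IsMul2Cocycle (cocycle e ψ P) := by
  refine ⟨by simp [cocycle, form], fun x y z => ?_⟩
  simp only [cocycle, ← AddChar.map_add_eq_mul, form_cocycle h2]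

theorem commPairing_cocycle (ψ : AddChar F ℂˣ) (P : CocycleParam F) (x y : Heisenberg R) :
    commPairing (cocycle e ψ P) x y = ψ (form e P x y - form e P y x) := by
  simp [commPairing, cocycle, AddChar.map_sub_eq_div, div_eq_mul_inv]

theorem invariants_cocycle (h2 : (2 : F) ≠ 0) (ψ : AddChar F ℂˣ) (P : CocycleParam F) :
    invariants (ofCoords e 0 1) (cocycle e ψ P) =
      ψ ∘ ![P.u₁, P.u₀, P.v₁, P.v₀, P.m, P.n, P.q, P.m + P.n + P.r - 2⁻¹ * (P.u₀ + P.v₀)] := by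
  ext i
  fin_cases i <;>
    simp [invariants, commPairing_cocycle, form]
  congr 2
  field_simp
  ring

theorem exists_comm_of_isGood (h2 : (2 : F) ≠ 0) {P : CocycleParam F} (hP : P.IsGood)
    {x : Heisenberg R} (hx : x ≠ 1) :
    ∃ y, x * y = y * x ∧ form e P x y - form e P y x ≠ 0 := by
  obtain ⟨hw, hd⟩ := hP
  by_contra! H
  have hC := H ⟨0, 0, ofCoords e 1 0⟩ (by rw [mul_comm_iff]; simp)
  have hC' := H ⟨0, 0, ofCoords e 0 1⟩ (by rw [mul_comm_iff]; simp)
  simp only [form, map_zero, TrivSqZeroExt.fst_zero, TrivSqZeroExt.snd_zero, fst_ofCoords,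
    snd_ofCoords] at hC hC'
  obtain ⟨r₀, r₁, ha₀, hb₀, ha₁, hb₁⟩ := CocycleParam.exists_coords_of_mul_eq_zero
    (a₀ := (e x.a).fst) (a₁ := (e x.a).snd) (b₀ := (e x.b).fst) (b₁ := (e x.b).snd)
    (u₁ := P.u₁) (v₁ := P.v₁) hw (by linear_combination -hC') (by linear_combination -hC)
  have hW := H ⟨ofCoords e (-P.v₀) (-P.v₁), ofCoords e P.u₀ P.u₁, 0⟩ (by
    rw [commute_iff_coords e]
    simp only [fst_ofCoords, snd_ofCoords, ha₀, hb₀, ha₁, hb₁]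
    constructor <;> ring)
  have hW' := H ⟨ofCoords e 0 (-P.v₀), ofCoords e 0 P.u₀, 0⟩ (by
    rw [commute_iff_coords e]
    simp only [fst_ofCoords, snd_ofCoords, ha₀, hb₀, ha₁, hb₁]
    constructor <;> ring)
  simp only [form, map_zero, TrivSqZeroExt.fst_zero, TrivSqZeroExt.snd_zero, fst_ofCoords,
    snd_ofCoords, ha₀, hb₀, ha₁, hb₁] at hW hW'
  have hr₀ : r₀ * P.disc = 0 := by
    refine (mul_eq_zero.mp ?_).resolve_left h2
    rw [CocycleParam.disc]
    field_simp at hW'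
    linear_combination hW'
  have hr₀ : r₀ = 0 := (mul_eq_zero.mp hr₀).resolve_right hd
  subst hr₀
  have hr₁ : r₁ * P.disc = 0 := by
    refine (mul_eq_zero.mp ?_).resolve_left h2
    rw [CocycleParam.disc]
    field_simp at hW
    linear_combination -hW
  have hr₁ : r₁ = 0 := (mul_eq_zero.mp hr₁).resolve_right hd
  subst hr₁
  simp only [zero_mul, neg_zero, add_zero] at ha₀ hb₀ ha₁ hb₁
  have hxa : x.a = 0 := coords_ext e (by simpa using ha₀) (by simpa using ha₁)
  have hxb : x.b = 0 := coords_ext e (by simpa using hb₀) (by simpa using hb₁)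
  have hA := H ⟨ofCoords e 1 0, 0, 0⟩ (by rw [mul_comm_iff]; simp [hxb])
  have hA' := H ⟨ofCoords e 0 1, 0, 0⟩ (by rw [mul_comm_iff]; simp [hxb])
  have hB := H ⟨0, ofCoords e 1 0, 0⟩ (by rw [mul_comm_iff]; simp [hxa])
  have hB' := H ⟨0, ofCoords e 0 1, 0⟩ (by rw [mul_comm_iff]; simp [hxa])
  simp [form, hxa, hxb] at hA hA' hB hB'
  have key : (e x.c).fst = 0 ∧ (e x.c).snd = 0 := by
    by_cases hu : P.u₀ = 0
    · have hv : P.v₀ ≠ 0 := fun hv => hw (by rw [hu, hv]; rfl)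
      have h0 : (e x.c).fst = 0 := by simpa [hv] using hB'
      refine ⟨h0, ?_⟩
      simpa [h0, hv] using hB
    · have h0 : (e x.c).fst = 0 := by simpa [hu] using hA'
      refine ⟨h0, ?_⟩
      simpa [h0, hu] using hA
  exact hx (Heisenberg.ext hxa hxb (coords_ext e (by simpa using key.1) (by simpa using key.2)))

theorem exists_radical_of_not_isGood (h2 : (2 : F) ≠ 0) {P : CocycleParam F} (hP : ¬ P.IsGood) :
    ∃ x : Heisenberg R, x ≠ 1 ∧ ∀ y, x * y = y * x → form e P x y - form e P y x = 0 := by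
  by_cases hw : (P.u₀, P.v₀) = 0
  · obtain ⟨hu, hv⟩ := Prod.mk.inj hw
    refine ⟨⟨0, 0, ofCoords e 0 1⟩, fun h => ?_, fun y _ => ?_⟩
    · have := congrArg (fun x : Heisenberg R => (e x.c).snd) h
      simp at this
    · simp [form, hu, hv]
  · have hd : P.disc = 0 := by
      by_contra hd
      exact hP ⟨hw, hd⟩
    refine ⟨⟨ofCoords e (-P.v₀) (-P.v₁), ofCoords e P.u₀ P.u₁, 0⟩, fun h => hw ?_, fun y hy => ?_⟩
    · have h₁ := congrArg (fun x : Heisenberg R => (e x.a).fst) h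
      have h₂ := congrArg (fun x : Heisenberg R => (e x.b).fst) h
      simp at h₁ h₂
      rw [h₁, h₂]
      rfl
    · rw [commute_iff_coords e] at hy
      simp only [fst_ofCoords, snd_ofCoords] at hy
      obtain ⟨r₀, r₁, ha₀, hb₀, ha₁, hb₁⟩ := CocycleParam.exists_coords_of_mul_eq_zero
        (a₀ := (e y.a).fst) (a₁ := (e y.a).snd) (b₀ := (e y.b).fst) (b₁ := (e y.b).snd)
        (u₁ := P.u₁) (v₁ := P.v₁) hw (by linear_combination hy.1) (by linear_combination hy.2)
      rw [CocycleParam.disc] at hd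
      simp only [form, map_zero, TrivSqZeroExt.fst_zero, TrivSqZeroExt.snd_zero, fst_ofCoords,
        snd_ofCoords, ha₀, hb₀, ha₁, hb₁]
      field_simp
      linear_combination 2 * r₁ * hd

end Heisenberg

end DualNumbers

section Classification

theorem SchurMultiplier.mk_eq_iff {G : Type*} [Group G] {α β : mul2Cocycles G} :
    (QuotientGroup.mk α : SchurMultiplier G) = QuotientGroup.mk β ↔
      IsMul2Coboundary (α⁻¹ * β).1 :=
  QuotientGroup.eq

theorem SchurMultiplier.commPairing_eq {G : Type*} [Group G] {α β : mul2Cocycles G}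
    (h : (QuotientGroup.mk α : SchurMultiplier G) = QuotientGroup.mk β) {x y : G}
    (hxy : x * y = y * x) : commPairing α.1 x y = commPairing β.1 x y := by
  have h1 := (mk_eq_iff.mp h).commPairing_eq_one hxy
  rw [Subgroup.coe_mul, Subgroup.coe_inv, commPairing_mul, commPairing_inv] at h1
  exact inv_mul_eq_one.mp h1

theorem SchurMultiplier.isNonDegenerate_iff_of_mk_eq {G : Type} [Group G] [Finite G]
    {α β : mul2Cocycles G} (h : (QuotientGroup.mk α : SchurMultiplier G) = QuotientGroup.mk β) :
    IsNonDegenerate α.1 ↔ IsNonDegenerate β.1 := by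
  rw [isNonDegenerate_iff α.2, isNonDegenerate_iff β.2]
  refine forall₂_congr fun x _ => exists_congr fun y => and_congr_right fun hxy => ?_
  rw [commPairing_eq h hxy]

theorem exists_injective_addChar_zmod (p : ℕ) [NeZero p] : ∃ ψ : AddChar (ZMod p) ℂˣ,
    Function.Injective ψ ∧ ∀ z : ℂˣ, z ^ p = 1 → ∃ k, ψ k = z := by
  have hζ := Complex.isPrimitiveRoot_exp p (NeZero.ne p)
  set ζ := Complex.exp (2 * Real.pi * Complex.I / p)
  let u : ℂˣ := (hζ.isUnit (NeZero.ne p)).unit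
  have hu : IsPrimitiveRoot u p := IsPrimitiveRoot.coe_units_iff.mp hζ
  refine ⟨AddChar.zmodChar p hu.pow_eq_one, fun a b hab => ?_, fun z hz => ?_⟩
  · rw [AddChar.zmodChar_apply, AddChar.zmodChar_apply] at hab
    exact ZMod.val_injective p (hu.pow_inj a.val_lt b.val_lt hab)
  · obtain ⟨i, hi, h⟩ := hζ.eq_pow_of_pow_eq_one (ξ := (z : ℂ)) 
      (by rw [← Units.val_pow_eq_pow_val, hz, Units.val_one])
    refine ⟨i, Units.ext ?_⟩
    rw [AddChar.zmodChar_apply, ZMod.val_cast_of_lt hi, ← h]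
    rfl

namespace Heisenberg

section Invariants

variable {R : Type*} [CommRing R]

theorem invariants_mul (t : R) (α β : Heisenberg R × Heisenberg R → ℂˣ) :
    invariants t (α * β) = invariants t α * invariants t β := by
  ext i
  fin_cases i <;> simp [invariants, commPairing_mul]

theorem invariants_inv (t : R) (α : Heisenberg R × Heisenberg R → ℂˣ) :
    invariants t α⁻¹ = (invariants t α)⁻¹ := by
  ext i
  fin_cases i <;> simp [invariants, commPairing_inv]

theorem invariants_eq_of_mk_eq {t : R} (ht : t * t = 0) {α β : mul2Cocycles (Heisenberg R)}
    (h : (QuotientGroup.mk α : SchurMultiplier (Heisenberg R)) = QuotientGroup.mk β) :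
    invariants t α.1 = invariants t β.1 := by
  ext i
  fin_cases i <;>
    exact congrArg Units.val (SchurMultiplier.commPairing_eq h (by rw [mul_comm_iff]; simp [ht]))

theorem invariants_pow {t : R} (ht : t * t = 0) {p : ℕ} (hp : (p : R) = 0)
    (α : mul2Cocycles (Heisenberg R)) (i : Fin 8) : invariants t α.1 i ^ p = 1 := by
  have key : ∀ x y : Heisenberg R, x * y = y * x → y.b * y.a = 0 →
      commPairing α.1 x y ^ p = 1 := fun x y hxy hy => by
    rw [← α.2.commPairing_pow_right hxy, pow_eq hy]
    simp only [hp, zero_mul]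
    exact α.2.commPairing_one_right x
  fin_cases i <;> exact key _ _ (by rw [mul_comm_iff]; simp [ht]) (by simp [ht])

end Invariants

variable {F : Type*} [Field F] {R : Type*} [CommRing R] (e : R ≃+* DualNumber F)

theorem mul_self_ofCoords : ofCoords e 0 1 * ofCoords e 0 1 = 0 :=
  coords_ext e (by simp) (by simp)

theorem induction_coords {p : ℕ} [Fact p.Prime] (e : R ≃+* DualNumber (ZMod p)) (P : R → Prop)
    (h0 : P 0) (h1 : P 1) (ht : P (ofCoords e 0 1)) (hadd : ∀ r s, P r → P s → P (r + s)) (r : R) :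
    P r := by
  have hmul : ∀ s, P s → ∀ n : ℕ, P (n • s) := fun s hs n => by
    induction n with
    | zero => simpa using h0
    | succ n ih => rw [succ_nsmul]; exact hadd _ _ ih hs
  have hr : r = (e r).fst.val • (1 : R) + (e r).snd.val • ofCoords e 0 1 :=
    coords_ext e
      (by simp [-ZMod.natCast_val, ZMod.natCast_zmod_val])
      (by simp [-ZMod.natCast_val, ZMod.natCast_zmod_val])
  rw [hr]
  exact hadd _ _ (hmul _ h1 _) (hmul _ ht _)

/-- The cohomology class of the explicit cocycle. -/
def cocycleClass (h2 : (2 : F) ≠ 0) (ψ : AddChar F ℂˣ) (P : CocycleParam F) :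
    SchurMultiplier (Heisenberg R) :=
  QuotientGroup.mk ⟨cocycle e ψ P, isMul2Cocycle_cocycle e h2 ψ P⟩

theorem cocycleClass_injective (h2 : (2 : F) ≠ 0) {ψ : AddChar F ℂˣ}
    (hψ : Function.Injective ψ) : Function.Injective (cocycleClass e h2 ψ) := fun P Q h => by
  have h := invariants_eq_of_mk_eq (mul_self_ofCoords e) h
  rw [invariants_cocycle e h2, invariants_cocycle e h2] at h
  have h : ∀ i, _ := fun i => hψ (congrFun h i)
  have k0 : P.u₁ = Q.u₁ := h 0
  have k1 : P.u₀ = Q.u₀ := h 1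
  have k2 : P.v₁ = Q.v₁ := h 2
  have k3 : P.v₀ = Q.v₀ := h 3
  have k4 : P.m = Q.m := h 4
  have k5 : P.n = Q.n := h 5
  have k6 : P.q = Q.q := h 6
  have k7 : P.m + P.n + P.r - 2⁻¹ * (P.u₀ + P.v₀) = Q.m + Q.n + Q.r - 2⁻¹ * (Q.u₀ + Q.v₀) := h 7
  rw [k4, k5, k1, k3] at k7
  exact CocycleParam.ext k1 k0 k3 k2 k4 k5 k6 (by linear_combination k7)

theorem cocycleClass_surjective {p : ℕ} [Fact p.Prime] (e : R ≃+* DualNumber (ZMod p))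
    (h2 : (2 : ZMod p) ≠ 0) {ψ : AddChar (ZMod p) ℂˣ}
    (hψ : ∀ z : ℂˣ, z ^ p = 1 → ∃ k, ψ k = z) :
    Function.Surjective (cocycleClass e h2 ψ) := fun x => by
  induction x using QuotientGroup.induction_on with | H α => ?_
  have hp : (p : R) = 0 := coords_ext e (by simp) (by simp)
  choose k hk using fun i => hψ _ (invariants_pow (mul_self_ofCoords e) hp α i)
  refine ⟨⟨k 1, k 0, k 3, k 2, k 4, k 5, k 6, k 7 - k 4 - k 5 + 2⁻¹ * (k 1 + k 3)⟩,
    SchurMultiplier.mk_eq_iff.mpr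
      (isMul2Coboundary_of_invariants (mul_self_ofCoords e) (induction_coords e) _ ?_)⟩
  rw [Subgroup.coe_mul, Subgroup.coe_inv, invariants_mul, invariants_inv, inv_mul_eq_one,
    invariants_cocycle e h2]
  funext i
  rw [← hk i, Function.comp_apply]
  congr 1
  fin_cases i <;> simp
  ring

theorem isNonDegenerate_cocycle_iff {F R : Type} [Field F] [CommRing R] [Finite (Heisenberg R)]
    (e : R ≃+* DualNumber F) (h2 : (2 : F) ≠ 0) {ψ : AddChar F ℂˣ} (hψ : Function.Injective ψ)
    (P : CocycleParam F) : IsNonDegenerate (cocycle e ψ P) ↔ P.IsGood := by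
  have hψ1 : ∀ a, ψ a = 1 ↔ a = 0 := fun a => by
    rw [← AddChar.map_zero_eq_one ψ, hψ.eq_iff]
  simp only [isNonDegenerate_iff (isMul2Cocycle_cocycle e h2 ψ P), commPairing_cocycle, ne_eq, hψ1]
  refine ⟨fun h => ?_, fun h x hx => exists_comm_of_isGood e h2 h hx⟩
  by_contra hP
  obtain ⟨x, hx, hrad⟩ := exists_radical_of_not_isGood e h2 hP
  obtain ⟨y, hxy, hy⟩ := h x hx
  exact hy (hrad y hxy)

theorem card_nondegenerate_classes {p : ℕ} [Fact p.Prime] {R : Type} [CommRing R]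
    (e : R ≃+* DualNumber (ZMod p)) (h2 : (2 : ZMod p) ≠ 0) :
    Nat.card {x : SchurMultiplier (Heisenberg R) | ∃ α : mul2Cocycles (Heisenberg R),
      (QuotientGroup.mk α : SchurMultiplier (Heisenberg R)) = x ∧ IsNonDegenerate α.1} =
      p ^ 5 * (p - 1) ^ 2 * (p + 1) := by
  have : Finite (DualNumber (ZMod p)) := inferInstanceAs (Finite (ZMod p × ZMod p))
  have : Finite R := Finite.of_equiv _ e.symm.toEquiv
  have : Finite (Heisenberg R) :=
    Finite.of_injective (fun x : Heisenberg R => (x.a, x.b, x.c)) fun x y h => by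
      simp only [Prod.mk.injEq] at h
      exact Heisenberg.ext h.1 h.2.1 h.2.2
  obtain ⟨ψ, hinj, hsurj⟩ := exists_injective_addChar_zmod p
  let Φ := Equiv.ofBijective _
    ⟨cocycleClass_injective e h2 hinj, cocycleClass_surjective e h2 hsurj⟩
  have hcard := CocycleParam.card_good (F := ZMod p)
  rw [Nat.card_zmod] at hcard
  rw [← hcard]
  refine (Nat.card_congr (Φ.subtypeEquiv fun P => ?_)).symm
  rw [← isNonDegenerate_cocycle_iff e h2 hinj]
  refine ⟨fun h => ⟨_, rfl, h⟩, ?_⟩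
  rintro ⟨α, hα, h⟩
  exact (SchurMultiplier.isNonDegenerate_iff_of_mk_eq hα).mp h

end Heisenberg

/-- `F[X] / (X²)` is the ring of dual numbers. -/
noncomputable def quotientXSqEquivDualNumber (F : Type*) [Field F] :
    (F[X] ⧸ Ideal.span {(X : F[X]) ^ 2}) ≃+* DualNumber F := by
  let φ : F[X] →+* DualNumber F := (aeval DualNumber.eps : F[X] →ₐ[F] DualNumber F)
  have hφ : ∀ f : F[X], (φ f).fst = f.coeff 0 ∧ (φ f).snd = f.coeff 1 := fun f => by
    induction f using Polynomial.induction_on' with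
    | add f g hf hg => simp [hf, hg]
    | monomial n a =>
      rcases n with _ | _ | n
      · simp [φ, TrivSqZeroExt.algebraMap_eq_inl]
      · simp [φ, TrivSqZeroExt.algebraMap_eq_inl]
      · have : (DualNumber.eps : DualNumber F) ^ (n + 2) = 0 := by
          rw [pow_add, sq, DualNumber.eps_mul_eps, mul_zero]
        simp [φ, this, coeff_monomial]
  have hker : Ideal.span {(X : F[X]) ^ 2} = RingHom.ker φ := by
    ext f
    rw [Ideal.mem_span_singleton, X_pow_dvd_iff, RingHom.mem_ker, TrivSqZeroExt.ext_iff,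
      (hφ f).1, (hφ f).2]
    refine ⟨fun h => ⟨h 0 (by norm_num), h 1 (by norm_num)⟩, fun h d hd => ?_⟩
    interval_cases d
    exacts [h.1, h.2]
  refine (Ideal.quotEquivOfEq hker).trans
    (RingHom.quotientKerEquivOfSurjective (f := φ) fun x => ⟨C x.fst + C x.snd * X, ?_⟩)
  exact TrivSqZeroExt.ext ((hφ _).1.trans (by simp)) ((hφ _).2.trans (by simp))

end Classification

/-- For `p` an odd prime and `G = H₃(𝔽_p[t]/(t²))`, the number of cohomology classes in
`H²(G, ℂˣ)` containing a non-degenerate `2`-cocycle equals `p⁵(p-1)²(p+1)`. -/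
theorem card_nondegenerate_classes_heisenberg_dual (p : ℕ) [Fact p.Prime]
    (hodd : Odd p) :
    Nat.card {x : SchurMultiplier
          (Heisenberg ((ZMod p)[X] ⧸ Ideal.span {(X : (ZMod p)[X]) ^ 2})) |
        ∃ α : mul2Cocycles
            (Heisenberg ((ZMod p)[X] ⧸ Ideal.span {(X : (ZMod p)[X]) ^ 2})),
          (QuotientGroup.mk α :
            SchurMultiplier
              (Heisenberg ((ZMod p)[X] ⧸ Ideal.span {(X : (ZMod p)[X]) ^ 2}))) = x ∧
          IsNonDegenerate
            ((α : Heisenberg ((ZMod p)[X] ⧸ Ideal.span {(X : (ZMod p)[X]) ^ 2}) ×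
                  Heisenberg ((ZMod p)[X] ⧸ Ideal.span {(X : (ZMod p)[X]) ^ 2}) → ℂˣ))} =
      p ^ 5 * (p - 1) ^ 2 * (p + 1) := by
  refine Heisenberg.card_nondegenerate_classes (quotientXSqEquivDualNumber (ZMod p)) fun h => ?_
  have h' : ((2 : ℕ) : ZMod p) = 0 := by exact_mod_cast h
  have hp2 := (ZMod.natCast_eq_zero_iff 2 p).mp h'
  rw [(Nat.prime_dvd_prime_iff_eq (Fact.out : p.Prime) Nat.prime_two).mp hp2] at hodd
  exact absurd hodd (by decide)
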